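/- Let μ be a locally finite ℂ^l-valued charge on ℝ^d with \underline{dim}_H μ < ∞ and ε > 0. Then there exist a point x ∈ supp μ, a vector a ∈ ℂ^l \ {0}, and a non-zero non-negative measure ν on ℝ^d such that: (1) a ⊗ ν ∈ Tan(μ, x); (2) liminf_{r→0} log ν(B(0,r))/log r ≤ \underline{dim}_H μ + ε; (3) ν is a tempered distribution. -/

import Mathlib

open MeasureTheory Metric Set Filter Topology
open scoped ENNReal NNReal CompactlySupported

open Classical in
/-- Rising sun lemma, forward version. -/
lemma card_forward_steep_le {w : ℕ → ℝ} (hw : Monotone w) {s : ℝ} (K a : ℕ) (ha : a ≤ K) :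
    s * ((Finset.Ico a K).filter
      (fun k : ℕ => ∃ i : ℕ, k < i ∧ i ≤ K ∧ s * ((i : ℝ) - k) < w i - w k)).card ≤ w K - w a := by
  set P : ℕ → Prop := fun k : ℕ => ∃ i : ℕ, k < i ∧ i ≤ K ∧ s * ((i : ℝ) - k) < w i - w k with hP
  rcases lt_or_ge s 0 with hs | hs
  · have := hw ha
    nlinarith [(Nat.cast_nonneg ((Finset.Ico a K).filter P).card : (0 : ℝ) ≤ _)]
  induction h : K - a using Nat.strong_induction_on generalizing a with
  | _ n ih =>
    rcases ha.eq_or_lt with rfl | hlt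
    · simp
    by_cases hb : P a
    · obtain ⟨i, hai, hiK, hi⟩ := hb
      have h1 := ih (K - i) (by omega) i hiK rfl
      have hcard : ((Finset.Ico a K).filter P).card ≤ (i - a) + ((Finset.Ico i K).filter P).card := by
        rw [← Finset.Ico_union_Ico_eq_Ico hai.le hiK, Finset.filter_union]
        refine (Finset.card_union_le _ _).trans ?_
        gcongr
        simpa using Finset.card_filter_le (Finset.Ico a i) P
      have hcard' : (((Finset.Ico a K).filter P).card : ℝ) ≤
          ((i : ℝ) - a) + ((Finset.Ico i K).filter P).card := by
        rw [← Nat.cast_sub hai.le]; exact_mod_cast hcard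
      nlinarith [mul_le_mul_of_nonneg_left hcard' hs]
    · have h1 := ih (K - (a + 1)) (by omega) (a + 1) hlt rfl
      have : (Finset.Ico a K).filter P = (Finset.Ico (a + 1) K).filter P := by
        ext k
        simp only [Finset.mem_filter, Finset.mem_Ico]
        constructor
        · rintro ⟨⟨h1, h2⟩, h3⟩
          refine ⟨⟨?_, h2⟩, h3⟩
          rcases h1.eq_or_lt with rfl | h
          · exact absurd h3 hb
          · exact h
        · rintro ⟨⟨h1, h2⟩, h3⟩
          exact ⟨⟨by omega, h2⟩, h3⟩
      rw [this]
      linarith [hw (Nat.le_succ a)]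

open Classical in
/-- Rising sun lemma, backward version. -/
lemma card_backward_steep_le {w : ℕ → ℝ} (hw : Monotone w) {s : ℝ} (K : ℕ) :
    s * ((Finset.Ioc 0 K).filter
      (fun k : ℕ => ∃ i : ℕ, i < k ∧ s * ((k : ℝ) - i) < w k - w i)).card ≤ w K - w 0 := by
  set P : ℕ → Prop := fun k : ℕ => ∃ i : ℕ, i < k ∧ s * ((k : ℝ) - i) < w k - w i with hP
  rcases lt_or_ge s 0 with hs | hs
  · have := hw (Nat.zero_le K)
    nlinarith [(Nat.cast_nonneg ((Finset.Ioc 0 K).filter P).card : (0 : ℝ) ≤ _)]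
  induction K using Nat.strong_induction_on with
  | _ K ih =>
    rcases K.eq_zero_or_pos with rfl | hlt
    · simp
    by_cases hb : P K
    · obtain ⟨i, hiK, hi⟩ := hb
      have h1 := ih i hiK
      have hcard : ((Finset.Ioc 0 K).filter P).card ≤ ((Finset.Ioc 0 i).filter P).card + (K - i) := by
        rw [← Finset.Ioc_union_Ioc_eq_Ioc (Nat.zero_le i) hiK.le, Finset.filter_union]
        refine (Finset.card_union_le _ _).trans ?_
        gcongr
        simpa using Finset.card_filter_le (Finset.Ioc i K) P
      have hcard' : (((Finset.Ioc 0 K).filter P).card : ℝ) ≤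
          ((Finset.Ioc 0 i).filter P).card + ((K : ℝ) - i) := by
        rw [← Nat.cast_sub hiK.le]; exact_mod_cast hcard
      nlinarith [mul_le_mul_of_nonneg_left hcard' hs]
    · have h1 := ih (K - 1) (by omega)
      have : (Finset.Ioc 0 K).filter P = (Finset.Ioc 0 (K - 1)).filter P := by
        ext k
        simp only [Finset.mem_filter, Finset.mem_Ioc]
        constructor
        · rintro ⟨⟨h1, h2⟩, h3⟩
          refine ⟨⟨h1, ?_⟩, h3⟩
          rcases h2.eq_or_lt with rfl | h
          · exact absurd h3 hb
          · omega
        · rintro ⟨⟨h1, h2⟩, h3⟩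
          exact ⟨⟨h1, by omega⟩, h3⟩
      rw [this]
      linarith [hw (Nat.sub_le K 1)]

/-- A monotone sequence growing at rate at most `s` along a subsequence has arbitrarily late
indices at which its forward slopes are at most `t > s` and its backward slopes are bounded by a
uniform constant `N`. -/
lemma exists_slope_controlled_index {w : ℕ → ℝ} (hw : Monotone w) {s t : ℝ} (hs : 0 < s)
    (hst : s < t) (hfreq : ∃ᶠ k : ℕ in atTop, w k ≤ s * k) :
    ∃ N : ℕ, ∀ n : ℕ, ∃ k, n ≤ k ∧ (∀ i ≤ n, w (k + i) ≤ w k + t * i) ∧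
      ∀ i ≤ n, w k ≤ w (k - i) + N * i := by
  classical
  have ht : 0 < t := hs.trans hst
  set p := (s + t) / 2 with hp
  obtain ⟨N, hN⟩ := exists_nat_gt (4 * p / (1 - p / t))
  have hpt : p / t < 1 := by rw [div_lt_one ht]; linarith
  have hp0 : 0 < p := by positivity
  have hN0 : (0 : ℝ) < N := lt_of_le_of_lt (by have := sub_pos.2 hpt; positivity) hN
  set q := 1 - p / t with hq
  have hq0 : 0 < q := sub_pos.2 hpt
  refine ⟨N, fun n => ?_⟩
  obtain ⟨K, hKs, hK1, hK2⟩ := (hfreq.and_eventually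
    ((tendsto_natCast_atTop_atTop.eventually_ge_atTop (-w 0 / (p - s))).and
      (tendsto_natCast_atTop_atTop.eventually_gt_atTop ((2 * n + 2) / (q / 2))))).exists
  have hps : 0 < p - s := by rw [hp]; linarith
  rw [div_le_iff₀ hps] at hK1
  rw [div_lt_iff₀ (by positivity)] at hK2
  have hwK : w K - w 0 ≤ p * K := by nlinarith
  have hF := card_forward_steep_le hw (s := t) K 0 (Nat.zero_le K)
  have hB := card_backward_steep_le hw (s := N) K
  set F := (Finset.Ico 0 K).filter
      (fun k : ℕ => ∃ i : ℕ, k < i ∧ i ≤ K ∧ t * ((i : ℝ) - k) < w i - w k) with hFdef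
  set B := (Finset.Ioc 0 K).filter
      (fun k : ℕ => ∃ i : ℕ, i < k ∧ (N : ℝ) * ((k : ℝ) - i) < w k - w i) with hBdef
  have hF' : (F.card : ℝ) ≤ p / t * K := by
    rw [div_mul_eq_mul_div, le_div_iff₀ ht]; linarith
  have hB' : (B.card : ℝ) ≤ q / 4 * K := by
    have h1 : 4 * p < N * q := by rwa [div_lt_iff₀ hq0] at hN
    have h2 : (N : ℝ) * B.card ≤ N * (q / 4 * K) := by
      have : (0 : ℝ) ≤ K := Nat.cast_nonneg K
      nlinarith
    exact le_of_mul_le_mul_left h2 hN0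
  have hnK : 2 * n + 2 ≤ K := by
    have : (2 * n + 2 : ℝ) < K := by
      have : 0 < p / t := by positivity
      have : q ≤ 1 := by linarith
      have : (0 : ℝ) ≤ K := Nat.cast_nonneg K
      nlinarith
    exact_mod_cast this.le
  have hlt : (F ∪ B).card < (Finset.Icc (n + 1) (K - n)).card := by
    have h1 : (F ∪ B).card ≤ F.card + B.card := Finset.card_union_le _ _
    rw [Nat.card_Icc]
    have h2 : F.card + B.card + 2 * n < K := by
      have : (F.card + B.card + 2 * n : ℝ) < K := by
        have : (0 : ℝ) ≤ K := Nat.cast_nonneg K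
        nlinarith
      exact_mod_cast this
    omega
  obtain ⟨k, hk, hkn⟩ := Finset.exists_mem_notMem_of_card_lt_card hlt
  simp only [Finset.mem_Icc, Finset.mem_union, hFdef, hBdef, Finset.mem_filter, Finset.mem_Ico,
    Finset.mem_Ioc, not_or, not_and, not_exists, not_lt] at hk hkn
  obtain ⟨hkF, hkB⟩ := hkn
  refine ⟨k, by omega, fun i hi => ?_, fun i hi => ?_⟩
  · rcases i.eq_zero_or_pos with rfl | hi0
    · simp
    have := hkF ⟨Nat.zero_le _, by omega⟩ (k + i) (by omega) (by omega)
    push_cast at this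
    linarith
  · rcases i.eq_zero_or_pos with rfl | hi0
    · simp
    have := hkB ⟨by omega, by omega⟩ (k - i) (by omega)
    rw [Nat.cast_sub (by omega)] at this
    linarith

/-- If `F` has Hausdorff dimension less than `s`, then at almost every point of `F` a measure
charges infinitely many dyadic balls at least as much as the `s`-th power of their radius. -/
lemma ae_frequently_le_measure_closedBall {X : Type*} [MetricSpace X] [MeasurableSpace X]
    [BorelSpace X] (m : Measure X) {F : Set X} (hF : MeasurableSet F) {s : ℝ≥0}
    (hs : 0 < s) (hdim : dimH F < s) :
    ∀ᵐ x ∂m, x ∈ F → ∃ᶠ k : ℕ in atTop,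
      ENNReal.ofReal ((1 / 2) ^ k) ^ (s : ℝ) ≤ m (closedBall x ((1 / 2) ^ k)) := by
  have hs' : (0 : ℝ) < s := hs
  set A : ℕ → Set X := fun n => {x | x ∈ F ∧ ∀ k ≥ n,
    m (closedBall x ((1 / 2) ^ k)) < ENNReal.ofReal ((1 / 2) ^ k) ^ (s : ℝ)} with hA
  have hnull : ∀ n, m (A n) = 0 := by
    intro n
    set c : ℝ≥0∞ := ENNReal.ofReal 2 ^ (s : ℝ) with hc
    have hc0 : c ≠ 0 := by simp [hc]
    have hctop : c ≠ ∞ := by simp [hc]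
    have hle : c⁻¹ • m.restrict (A n) ≤ μH[s] := by
      refine Measure.le_hausdorffMeasure _ _ (ENNReal.ofReal ((1 / 2) ^ n)) (by positivity) ?_
      intro u hu
      rw [Measure.smul_apply, smul_eq_mul, mul_comm, ← div_eq_mul_inv]
      refine ENNReal.div_le_of_le_mul ?_
      refine (measure_mono subset_closure).trans ?_
      rw [Measure.restrict_apply isClosed_closure.measurableSet]
      rcases (closure u ∩ A n).eq_empty_or_nonempty with he | ⟨x, hxu, hx⟩
      · simp [he]
      have hball : ∀ k ≥ n, ediam u ≤ ENNReal.ofReal ((1 / 2) ^ k) →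
          m (closure u ∩ A n) ≤ ENNReal.ofReal ((1 / 2) ^ k) ^ (s : ℝ) := by
        intro k hk huk
        refine le_trans (measure_mono ?_) (hx.2 k hk).le
        rintro y ⟨hy, -⟩
        rw [← Metric.closedEBall_ofReal (by positivity)]
        rw [Metric.mem_closedEBall]
        refine (Metric.edist_le_ediam_of_mem hy hxu).trans ?_
        rwa [Metric.ediam_closure]
      rcases eq_or_ne (ediam u) 0 with h0 | h0
      · have hlim : Tendsto (fun k : ℕ => ENNReal.ofReal ((1 / 2) ^ k) ^ (s : ℝ)) atTop (𝓝 0) := by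
          have h1 : Tendsto (fun k : ℕ => ENNReal.ofReal ((1 / 2) ^ k)) atTop (𝓝 0) := by
            have := ENNReal.tendsto_ofReal (tendsto_pow_atTop_nhds_zero_of_lt_one
              (r := (1 / 2 : ℝ)) (by norm_num) (by norm_num))
            simpa using this
          have := ((ENNReal.continuous_rpow_const (y := (s : ℝ))).tendsto 0).comp h1
          rw [ENNReal.zero_rpow_of_pos hs'] at this
          exact this
        have : m (closure u ∩ A n) ≤ 0 := by
          refine ge_of_tendsto hlim ?_
          filter_upwards [eventually_ge_atTop n] with k hk
          exact hball k hk (by simp [h0])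
        exact this.trans zero_le
      · have hfin : ediam u ≠ ∞ := ne_top_of_le_ne_top ENNReal.ofReal_ne_top hu
        have hpos : 0 < (ediam u).toReal := ENNReal.toReal_pos h0 hfin
        have hle : (ediam u).toReal ≤ (1 / 2) ^ n :=
          ENNReal.toReal_le_of_le_ofReal (by positivity) hu
        obtain ⟨k, hk1, hk2⟩ := exists_nat_pow_near_of_lt_one hpos
          (hle.trans (pow_le_one₀ (by norm_num) (by norm_num))) (y := (1 / 2 : ℝ))
          (by norm_num) (by norm_num)
        have hnk : n ≤ k := by
          have := (pow_lt_pow_iff_right_of_lt_one₀ (by norm_num : (0 : ℝ) < 1 / 2)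
            (by norm_num)).1 (hk1.trans_le hle)
          omega
        refine (hball k hnk ?_).trans ?_
        · rw [← ENNReal.ofReal_toReal hfin]
          exact ENNReal.ofReal_le_ofReal hk2
        · rw [hc, mul_comm, ← ENNReal.mul_rpow_of_nonneg _ _ hs'.le]
          refine ENNReal.rpow_le_rpow ?_ hs'.le
          rw [← ENNReal.ofReal_toReal hfin, ← ENNReal.ofReal_mul (by norm_num)]
          refine ENNReal.ofReal_le_ofReal ?_
          rw [pow_succ] at hk1
          linarith
    have h0 : (c⁻¹ • m.restrict (A n)) F = 0 :=
      le_antisymm ((hle F).trans (hausdorffMeasure_of_dimH_lt hdim).le) zero_le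
    rw [Measure.smul_apply, smul_eq_mul, mul_eq_zero, Measure.restrict_apply hF] at h0
    rcases h0 with h0 | h0
    · exact absurd h0 (by simpa using hctop)
    · rwa [inter_eq_right.2 (fun x hx => hx.1)] at h0
  filter_upwards [ae_all_iff.2 fun n => measure_eq_zero_iff_ae_notMem.1 (hnull n)] with x hx hxF
  rw [frequently_atTop]
  intro n
  by_contra! h
  exact hx n ⟨hxF, h⟩

/-- Vague sequential compactness of uniformly locally bounded sequences of measures on a proper
metric space. -/
lemma exists_subseq_tendsto_integral {X : Type*} [MetricSpace X] [ProperSpace X]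
    [MeasurableSpace X] [BorelSpace X] (o : X) (M : ℕ → Measure X)
    [∀ j, IsLocallyFiniteMeasure (M j)]
    (hM : ∀ R : ℝ, BddAbove (range fun j => (M j).real (closedBall o R))) :
    ∃ (ν : Measure X) (φ : ℕ → ℕ), IsLocallyFiniteMeasure ν ∧ StrictMono φ ∧
      ∀ f : C(X, ℝ), HasCompactSupport f →
        Tendsto (fun j => ∫ z, f z ∂(M (φ j))) atTop (𝓝 (∫ z, f z ∂ν)) := by
  have hχ : ∀ n : ℕ, ∃ χ : C(X, ℝ), EqOn χ 1 (closedBall o n) ∧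
      EqOn χ 0 (ball o (n + 1))ᶜ ∧ HasCompactSupport χ ∧ ∀ x, χ x ∈ Icc (0 : ℝ) 1 := fun n =>
    exists_continuous_one_zero_of_isCompact (isCompact_closedBall o n) isOpen_ball.isClosed_compl
      (disjoint_compl_right_iff_subset.2 (closedBall_subset_ball (by linarith)))
  choose χ hχ1 hχ0 hχc hχI using hχ
  choose B hB using fun n : ℕ => hM (n + 1)
  have hB' : ∀ (n : ℕ) j, (M j).real (closedBall o (n + 1)) ≤ B n := fun n j => hB n ⟨j, rfl⟩
  have hBpos : ∀ n, 0 ≤ B n := fun n => measureReal_nonneg.trans (hB' n 0)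
  have hint : ∀ n j (g : C(X, ℝ)), Integrable (fun z => χ n z * g z) (M j) := fun n j g =>
    ((χ n).continuous.mul g.continuous).integrable_of_hasCompactSupport (hχc n).mul_right
  have key : ∀ (n : ℕ) j (g : C(X, ℝ)) (ε : ℝ), (∀ z ∈ closedBall o (n + 1), |g z| ≤ ε) →
      |∫ z, χ n z * g z ∂(M j)| ≤ ε * B n := by
    intro n j g ε hg
    have hε : 0 ≤ ε := (abs_nonneg _).trans (hg o (mem_closedBall_self (by positivity)))
    rw [← setIntegral_eq_integral_of_forall_compl_eq_zero (s := closedBall o (n + 1))]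
    · refine le_trans ?_ (mul_le_mul_of_nonneg_left (hB' n j) hε)
      rw [← Real.norm_eq_abs]
      refine norm_setIntegral_le_of_norm_le_const measure_closedBall_lt_top fun z hz => ?_
      rw [Real.norm_eq_abs, abs_mul, abs_of_nonneg (hχI n z).1]
      exact (mul_le_of_le_one_left (abs_nonneg _) (hχI n z).2).trans (hg z hz)
    · intro z hz
      have : χ n z = 0 := hχ0 n fun h => hz (ball_subset_closedBall h)
      rw [this, zero_mul]
  set u := TopologicalSpace.denseSeq C(X, ℝ) with hu
  have hbd : ∀ p : ℕ × ℕ, ∃ b, ∀ j, (∫ z, χ p.1 z * u p.2 z ∂(M j)) ∈ Icc (-b) b := by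
    intro p
    obtain ⟨ε, hε⟩ := (isCompact_closedBall o (p.1 + 1 : ℝ)).exists_bound_of_continuousOn
      (u p.2).continuous.continuousOn
    exact ⟨ε * B p.1, fun j => abs_le.1 (key _ _ _ _ hε)⟩
  choose b hb using hbd
  obtain ⟨lim, -, φ, hφ, hlim⟩ := (isCompact_univ_pi fun p => isCompact_Icc (a := -b p)
    (b := b p)).tendsto_subseq (x := fun j p => ∫ z, χ p.1 z * u p.2 z ∂(M j))
      (fun j p _ => hb p j)
  rw [tendsto_pi_nhds] at hlim
  have hconv : ∀ f : C(X, ℝ), HasCompactSupport f →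
      ∃ L, Tendsto (fun j => ∫ z, f z ∂(M (φ j))) atTop (𝓝 L) := by
    intro f hf
    obtain ⟨R, hR⟩ := hf.isCompact.isBounded.subset_closedBall o
    obtain ⟨n, hn⟩ := exists_nat_ge R
    have hfχ : ∀ z, f z = χ n z * f z := by
      intro z
      by_cases hz : z ∈ closedBall o n
      · rw [hχ1 n hz]; simp
      · rw [image_eq_zero_of_notMem_tsupport fun h => hz (closedBall_subset_closedBall hn (hR h))]
        simp
    refine cauchySeq_tendsto_of_complete (Metric.cauchySeq_iff.2 fun ε hε => ?_)
    set δ := ε / (4 * (B n + 1)) with hδ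
    have hBn := hBpos n
    have hδ0 : 0 < δ := by positivity
    obtain ⟨i, hi⟩ : ∃ i, ∀ z ∈ closedBall o ((n : ℝ) + 1), |(f - u i) z| ≤ δ := by
      have hmem : {g : C(X, ℝ) | ∀ z ∈ closedBall o ((n : ℝ) + 1), dist (f z) (g z) < δ} ∈ 𝓝 f := by
        have := (ContinuousMap.tendsto_iff_forall_isCompact_tendstoUniformlyOn.1
          (tendsto_id (x := 𝓝 f))) _ (isCompact_closedBall o ((n : ℝ) + 1))
        exact Metric.tendstoUniformlyOn_iff.1 this δ hδ0
      obtain ⟨_, ⟨i, rfl⟩, hg⟩ := (TopologicalSpace.denseRange_denseSeq C(X, ℝ)).inter_nhds_nonempty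
        hmem
      exact ⟨i, fun z hz => (hg z hz).le⟩
    have hclose : ∀ j, |∫ z, f z ∂(M j) - ∫ z, χ n z * u i z ∂(M j)| ≤ ε / 4 := by
      intro j
      have h1 : ∫ z, f z ∂(M j) = ∫ z, χ n z * f z ∂(M j) := integral_congr_ae (.of_forall hfχ)
      rw [h1, ← integral_sub (hint n j f) (hint n j (u i))]
      have h2 := key n j (f - u i) δ hi
      simp only [ContinuousMap.sub_apply, mul_sub] at h2
      refine h2.trans ?_
      rw [hδ, div_mul_eq_mul_div, div_le_div_iff₀ (by positivity) (by positivity)]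
      nlinarith
    obtain ⟨J, hJ⟩ := Metric.cauchySeq_iff.1 (hlim (n, i)).cauchySeq (ε / 4) (by positivity)
    refine ⟨J, fun j hj k hk => ?_⟩
    have h1 := hJ j hj k hk
    have h2 := hclose (φ j)
    have h3 := hclose (φ k)
    simp only [Real.dist_eq, Function.comp] at h1 ⊢
    rw [abs_le] at h2 h3
    rw [abs_lt] at h1 ⊢
    constructor <;> linarith
  choose L hL using fun f : C_c(X, ℝ) => hconv f.toContinuousMap f.hasCompactSupport
  have hfi : ∀ (f : C_c(X, ℝ)) j, Integrable f (M j) := fun f j =>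
    f.continuous.integrable_of_hasCompactSupport f.hasCompactSupport
  let Λ : C_c(X, ℝ) →ₚ[ℝ] ℝ :=
  { toFun := L
    map_add' g g' := by
      refine tendsto_nhds_unique (hL (g + g')) (((hL g).add (hL g')).congr fun j => ?_)
      exact (integral_add (hfi g _) (hfi g' _)).symm
    map_smul' c g := by
      refine tendsto_nhds_unique (hL (c • g)) (((hL g).const_smul c).congr fun j => ?_)
      exact (integral_smul c g).symm
    monotone' g g' hgg' := by
      refine le_of_tendsto_of_tendsto' (hL g) (hL g') fun j => ?_
      exact integral_mono (hfi g _) (hfi g' _) hgg' }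
  refine ⟨RealRMK.rieszMeasure Λ, φ, ?_, hφ, fun f hf => ?_⟩
  · rw [RealRMK.rieszMeasure]; infer_instance
  · have h := RealRMK.integral_rieszMeasure Λ ⟨f, hf⟩
    change ∫ z, f z ∂_ = L ⟨f, hf⟩ at h
    rw [h]
    exact hL ⟨f, hf⟩
/-- Multiplicative form of `exists_slope_controlled_index` for positive antitone sequences. -/
lemma exists_decay_controlled_index {φ : ℕ → ℝ} (hφ : Antitone φ) (hpos : ∀ k, 0 < φ k) {s t : ℝ}
    (hs : 0 < s) (hst : s < t) (hfreq : ∃ᶠ k : ℕ in atTop, (2 : ℝ) ^ (-(s * k)) ≤ φ k) :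
    ∃ N : ℕ, ∀ n : ℕ, ∃ k, n ≤ k ∧ (∀ i ≤ n, φ k * 2 ^ (-(t * i)) ≤ φ (k + i)) ∧
      ∀ i ≤ n, φ (k - i) ≤ φ k * 2 ^ (N * i) := by
  have hmono : Monotone fun k => -Real.logb 2 (φ k) := fun a b hab =>
    neg_le_neg (Real.logb_le_logb_of_le (by norm_num) (hpos b) (hφ hab))
  obtain ⟨N, hN⟩ := exists_slope_controlled_index hmono hs hst <| hfreq.mono fun k hk => by
    have := Real.logb_le_logb_of_le (b := 2) (by norm_num) (by positivity) hk
    rw [Real.logb_rpow (by norm_num) (by norm_num)] at this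
    linarith
  refine ⟨N, fun n => ?_⟩
  obtain ⟨k, hnk, h1, h2⟩ := hN n
  refine ⟨k, hnk, fun i hi => ?_, fun i hi => ?_⟩
  · rw [← Real.logb_le_logb (b := 2) (by norm_num) (by have := hpos k; positivity) (hpos _),
      Real.logb_mul (hpos k).ne' (by positivity), Real.logb_rpow (by norm_num) (by norm_num)]
    linarith [h1 i hi]
  · rw [← Real.logb_le_logb (b := 2) (by norm_num) (hpos _) (by have := hpos k; positivity),
      Real.logb_mul (hpos k).ne' (by positivity), ← Real.rpow_natCast,
      Real.logb_rpow (by norm_num) (by norm_num)]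
    push_cast
    linarith [h2 i hi]

/-- A continuous compactly supported function whose integrals are squeezed between the measures of
two concentric balls. -/
lemma exists_integral_mem_Icc_measureReal_closedBall {X : Type*} [MetricSpace X] [ProperSpace X]
    [MeasurableSpace X] [BorelSpace X] (o : X) {a b : ℝ} (hab : a < b) :
    ∃ f : C(X, ℝ), HasCompactSupport f ∧ ∀ (μ : Measure X) [IsLocallyFiniteMeasure μ],
      ∫ z, f z ∂μ ∈ Icc (μ.real (closedBall o a)) (μ.real (closedBall o b)) := by
  obtain ⟨f, hf1, hf0, hfc, hfI⟩ := exists_continuous_one_zero_of_isCompact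
    (isCompact_closedBall o a) isOpen_ball.isClosed_compl
      (disjoint_compl_right_iff_subset.2 (closedBall_subset_ball hab))
  refine ⟨f, hfc, fun μ _ => ?_⟩
  have hint : Integrable f μ := f.continuous.integrable_of_hasCompactSupport hfc
  have hind : ∀ r, Integrable ((closedBall o r).indicator (1 : X → ℝ)) μ := fun r =>
    (integrable_indicator_iff measurableSet_closedBall).2
      (integrableOn_const measure_closedBall_lt_top.ne)
  rw [← integral_indicator_one measurableSet_closedBall,
    ← integral_indicator_one measurableSet_closedBall]
  constructor
  · refine integral_mono (hind a) hint fun z => ?_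
    by_cases hz : z ∈ closedBall o a
    · simp [hz, hf1 hz]
    · rw [indicator_of_notMem hz]; exact (hfI z).1
  · refine integral_mono hint (hind b) fun z => ?_
    by_cases hz : z ∈ closedBall o b
    · simpa [hz] using (hfI z).2
    · rw [indicator_of_notMem hz, hf0 fun h => hz (ball_subset_closedBall h)]; simp

section BlowUp

variable {E : Type*} [NormedAddCommGroup E] [NormedSpace ℝ E] [MeasurableSpace E] [BorelSpace E]

/-- The rescaled measure `c • T_{x,r}[m]`. -/
noncomputable def blowUp (m : Measure E) (x : E) (c r : ℝ) : Measure E :=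
  ENNReal.ofReal c • m.map fun y => r⁻¹ • (y - x)

lemma measureReal_blowUp_closedBall (m : Measure E) (x : E) {c r : ℝ} (hc : 0 < c) (hr : 0 < r)
    (R : ℝ) : (blowUp m x c r).real (closedBall 0 R) = c * m.real (closedBall x (r * R)) := by
  have hpre : (fun y => r⁻¹ • (y - x)) ⁻¹' closedBall 0 R = closedBall x (r * R) := by
    ext y
    rw [mem_preimage, mem_closedBall_zero_iff, mem_closedBall, norm_smul, norm_inv,
      Real.norm_of_nonneg hr.le, dist_eq_norm, inv_mul_le_iff₀ hr]
  rw [measureReal_def, blowUp, Measure.smul_apply,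
    Measure.map_apply (by fun_prop) measurableSet_closedBall, hpre, smul_eq_mul, ENNReal.toReal_mul,
    ENNReal.toReal_ofReal hc.le, measureReal_def]

lemma integral_blowUp (m : Measure E) (x : E) {c r : ℝ} (hc : 0 < c) (f : C(E, ℝ)) :
    ∫ z, f z ∂(blowUp m x c r) = c * ∫ y, f (r⁻¹ • (y - x)) ∂m := by
  rw [blowUp, integral_smul_measure, ENNReal.toReal_ofReal hc.le,
    integral_map (by fun_prop) f.continuous.aestronglyMeasurable, smul_eq_mul]

lemma isLocallyFiniteMeasure_blowUp [ProperSpace E] (m : Measure E) [IsLocallyFiniteMeasure m]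
    (x : E) {c r : ℝ} (hr : 0 < r) : IsLocallyFiniteMeasure (blowUp m x c r) := by
  refine ⟨fun z => ⟨closedBall z 1, closedBall_mem_nhds z one_pos, ?_⟩⟩
  rw [blowUp, Measure.smul_apply, Measure.map_apply (by fun_prop) measurableSet_closedBall]
  refine ENNReal.mul_lt_top ENNReal.ofReal_lt_top
    (lt_of_le_of_lt (measure_mono ?_) (measure_closedBall_lt_top (x := x + r • z) (r := r)))
  intro y hy
  rw [mem_preimage, mem_closedBall, dist_eq_norm] at hy
  rw [mem_closedBall, dist_eq_norm]
  have : y - (x + r • z) = r • (r⁻¹ • (y - x) - z) := by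
    rw [smul_sub, smul_inv_smul₀ hr.ne', sub_sub]
  rw [this, norm_smul, Real.norm_of_nonneg hr.le]
  nlinarith

/-- Blow-ups along scales with controlled growth and decay subconverge to a measure with the same
control. -/
lemma exists_tangent_measure [ProperSpace E] {m : Measure E} [IsLocallyFiniteMeasure m] {x : E}
    (hpos : ∀ k : ℕ, 0 < m.real (closedBall x ((1 / 2) ^ k))) {t : ℝ} {N : ℕ}
    (h : ∀ n : ℕ, ∃ k, n ≤ k ∧
      (∀ i ≤ n, m.real (closedBall x ((1 / 2) ^ k)) * 2 ^ (-(t * i)) ≤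
        m.real (closedBall x ((1 / 2) ^ (k + i)))) ∧
      ∀ i ≤ n, m.real (closedBall x ((1 / 2) ^ (k - i))) ≤
        m.real (closedBall x ((1 / 2) ^ k)) * 2 ^ (N * i)) :
    ∃ (ν : Measure E) (c r : ℕ → ℝ), IsLocallyFiniteMeasure ν ∧ (∀ j, 0 < c j) ∧ (∀ j, 0 < r j) ∧
      Tendsto r atTop (𝓝 0) ∧
      (∀ f : C(E, ℝ), HasCompactSupport f →
        Tendsto (fun j => c j * ∫ y, f ((r j)⁻¹ • (y - x)) ∂m) atTop (𝓝 (∫ z, f z ∂ν))) ∧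
      (∀ i : ℕ, ∀ᶠ j in atTop, c j * m.real (closedBall x (r j * 2 ^ i)) ≤ 2 ^ (N * i)) ∧
      (∀ i : ℕ, ν.real (closedBall 0 (2 ^ i)) ≤ 2 ^ (N * (i + 1))) ∧
      ∀ i : ℕ, (2 : ℝ) ^ (-(t * (i + 1))) ≤ ν.real (closedBall 0 ((1 / 2) ^ i)) := by
  choose κ hκ hdec hgro using h
  set r : ℕ → ℝ := fun n => (1 / 2) ^ κ n with hr
  set c : ℕ → ℝ := fun n => (m.real (closedBall x (r n)))⁻¹ with hc
  have hr0 : ∀ n, 0 < r n := fun n => by positivity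
  have hc0 : ∀ n, 0 < c n := fun n => inv_pos.2 (hpos _)
  have hrlim : Tendsto r atTop (𝓝 0) :=
    (tendsto_pow_atTop_nhds_zero_of_lt_one (by norm_num) (by norm_num)).comp
      (tendsto_atTop_mono hκ tendsto_id)
  have hup : ∀ i : ℕ, ∀ᶠ j in atTop, c j * m.real (closedBall x (r j * 2 ^ i)) ≤ 2 ^ (N * i) := by
    intro i
    filter_upwards [eventually_ge_atTop i] with j hj
    have hrad : r j * 2 ^ i = (1 / 2) ^ (κ j - i) := by
      obtain ⟨q, hq⟩ := Nat.exists_eq_add_of_le (hj.trans (hκ j))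
      simp only [hr]
      rw [hq, Nat.add_sub_cancel_left, pow_add, mul_right_comm, ← mul_pow]
      norm_num
    rw [hrad, inv_mul_le_iff₀ (hpos _)]
    exact hgro j i hj
  have hlow : ∀ i : ℕ, ∀ᶠ j in atTop,
      (2 : ℝ) ^ (-(t * i)) ≤ c j * m.real (closedBall x (r j * (1 / 2) ^ i)) := by
    intro i
    filter_upwards [eventually_ge_atTop i] with j hj
    rw [← pow_add, le_inv_mul_iff₀ (hpos _)]
    exact hdec j i hj
  have hfin : ∀ j, IsLocallyFiniteMeasure (blowUp m x (c j) (r j)) := fun j =>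
    isLocallyFiniteMeasure_blowUp m x (hr0 j)
  obtain ⟨ν, φ, hν, hφ, hlim⟩ := exists_subseq_tendsto_integral (0 : E)
    (fun j => blowUp m x (c j) (r j)) (fun R => by
      obtain ⟨i, hi⟩ := pow_unbounded_of_one_lt R (one_lt_two (α := ℝ))
      refine IsBoundedUnder.bddAbove_range ⟨2 ^ (N * i), ?_⟩
      rw [eventually_map]
      filter_upwards [hup i] with j hj
      rw [measureReal_blowUp_closedBall m x (hc0 j) (hr0 j)]
      refine le_trans (mul_le_mul_of_nonneg_left (measureReal_mono
        (closedBall_subset_closedBall ?_) measure_closedBall_lt_top.ne) (hc0 j).le) hj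
      exact mul_le_mul_of_nonneg_left hi.le (hr0 j).le)
  have hφt := hφ.tendsto_atTop
  refine ⟨ν, c ∘ φ, r ∘ φ, hν, fun j => hc0 _, fun j => hr0 _, hrlim.comp hφt, fun f hf => ?_,
    fun i => hφt.eventually (hup i), fun i => ?_, fun i => ?_⟩
  · refine (hlim f hf).congr fun j => ?_
    rw [integral_blowUp m x (hc0 _)]; rfl
  · obtain ⟨f, hfc, hf⟩ := exists_integral_mem_Icc_measureReal_closedBall (0 : E)
      (pow_lt_pow_right₀ (one_lt_two (α := ℝ)) (Nat.lt_succ_self i))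
    refine (hf ν).1.trans (le_of_tendsto (hlim f hfc) ?_)
    filter_upwards [hφt.eventually (hup (i + 1))] with j hj
    refine (hf _).2.trans ?_
    rwa [measureReal_blowUp_closedBall m x (hc0 _) (hr0 _)]
  · obtain ⟨f, hfc, hf⟩ := exists_integral_mem_Icc_measureReal_closedBall (0 : E)
      (pow_lt_pow_right_of_lt_one₀ (by norm_num : (0 : ℝ) < 1 / 2) (by norm_num)
        (Nat.lt_succ_self i))
    refine (ge_of_tendsto (hlim f hfc) ?_).trans (hf ν).2
    filter_upwards [hφt.eventually (hlow (i + 1))] with j hj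
    refine le_trans ?_ (hf _).1
    rw [measureReal_blowUp_closedBall m x (hc0 _) (hr0 _)]
    simpa using hj

/-- At a Lebesgue point `x` of `σ`, blow-ups of `σ m` with controlled growth behave like those of
`m` multiplied by the constant vector `σ x`. -/
lemma tendsto_smul_integral_of_lebesgue_point [ProperSpace E] {V : Type*} [NormedAddCommGroup V]
    [NormedSpace ℝ V] [CompleteSpace V] {m : Measure E} [IsLocallyFiniteMeasure m] {x : E}
    {σ : E → V} (hσ : LocallyIntegrable σ m)
    (hleb : Tendsto (fun ρ => ⨍ y in closedBall x ρ, ‖σ y - σ x‖ ∂m) (𝓝[>] 0) (𝓝 0))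
    {c r : ℕ → ℝ} (hc : ∀ j, 0 < c j) (hr : ∀ j, 0 < r j) (hrlim : Tendsto r atTop (𝓝 0))
    {N : ℕ} (hgrowth : ∀ i : ℕ, ∀ᶠ j in atTop,
      c j * m.real (closedBall x (r j * 2 ^ i)) ≤ 2 ^ (N * i))
    {f : C(E, ℝ)} (hf : HasCompactSupport f) {L : ℝ}
    (hlim : Tendsto (fun j => c j * ∫ y, f ((r j)⁻¹ • (y - x)) ∂m) atTop (𝓝 L)) :
    Tendsto (fun j => c j • ∫ y, f ((r j)⁻¹ • (y - x)) • σ y ∂m) atTop (𝓝 (L • σ x)) := by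
  obtain ⟨R, hR⟩ := hf.isCompact.isBounded.subset_closedBall 0
  obtain ⟨i, hi⟩ := pow_unbounded_of_one_lt R (one_lt_two (α := ℝ))
  obtain ⟨C, hC⟩ := hf.exists_bound_of_continuous f.continuous
  have hC0 : 0 ≤ C := (norm_nonneg _).trans (hC 0)
  set ball : ℕ → Set E := fun j => closedBall x (r j * 2 ^ i) with hball
  have hzero : ∀ j, ∀ y ∉ ball j, f ((r j)⁻¹ • (y - x)) = 0 := by
    intro j y hy
    refine image_eq_zero_of_notMem_tsupport fun h => hy ?_
    have h1 := hR h
    rw [mem_closedBall_zero_iff, norm_smul, norm_inv, Real.norm_of_nonneg (hr j).le,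
      inv_mul_le_iff₀ (hr j)] at h1
    rw [hball, mem_closedBall, dist_eq_norm]
    exact h1.trans (mul_le_mul_of_nonneg_left hi.le (hr j).le)
  have hfj : ∀ j, Continuous fun y => f ((r j)⁻¹ • (y - x)) := fun j => by fun_prop
  have hcs : ∀ j, HasCompactSupport fun y => f ((r j)⁻¹ • (y - x)) := fun j =>
    HasCompactSupport.intro (isCompact_closedBall x (r j * 2 ^ i)) (hzero j)
  have hint1 : ∀ j, Integrable (fun y => f ((r j)⁻¹ • (y - x)) • σ y) m := fun j =>
    hσ.integrable_smul_left_of_hasCompactSupport (hfj j) (hcs j)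
  have hint2 : ∀ j, Integrable (fun y => f ((r j)⁻¹ • (y - x)) • σ x) m := fun j =>
    ((hfj j).integrable_of_hasCompactSupport (hcs j)).smul_const _
  have hdiff : ∀ j, c j • ∫ y, f ((r j)⁻¹ • (y - x)) • σ y ∂m =
      c j • ∫ y, f ((r j)⁻¹ • (y - x)) • (σ y - σ x) ∂m +
        (c j * ∫ y, f ((r j)⁻¹ • (y - x)) ∂m) • σ x := by
    intro j
    simp_rw [smul_sub (f _)]
    rw [integral_sub (hint1 j) (hint2 j), integral_smul_const, mul_smul, smul_sub, sub_add_cancel]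
  simp_rw [hdiff]
  rw [← zero_add (L • σ x)]
  refine Tendsto.add ?_ (hlim.smul_const _)
  have hrad : Tendsto (fun j => r j * 2 ^ i) atTop (𝓝[>] 0) := by
    refine tendsto_nhdsWithin_iff.2 ⟨by simpa using hrlim.mul_const (2 ^ i), ?_⟩
    exact .of_forall fun j => mul_pos (hr j) (by positivity)
  have havg := (hleb.comp hrad).const_mul (C * 2 ^ (N * i))
  rw [mul_zero] at havg
  refine squeeze_zero_norm' ?_ havg
  filter_upwards [hgrowth i] with j hj
  have hloc : IntegrableOn (fun y => ‖σ y - σ x‖) (ball j) m :=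
    ((hσ.integrableOn_isCompact (isCompact_closedBall _ _)).sub
      (integrableOn_const measure_closedBall_lt_top.ne)).norm
  have hI : ‖∫ y, f ((r j)⁻¹ • (y - x)) • (σ y - σ x) ∂m‖ ≤
      C * ∫ y in ball j, ‖σ y - σ x‖ ∂m := by
    rw [← setIntegral_eq_integral_of_forall_compl_eq_zero (s := ball j)
      fun y hy => by rw [hzero j y hy, zero_smul], ← integral_const_mul]
    refine norm_integral_le_of_norm_le (hloc.const_mul C) (.of_forall fun y => ?_)
    rw [norm_smul]
    exact mul_le_mul_of_nonneg_right (hC _) (norm_nonneg _)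
  have havg_eq : ∫ y in ball j, ‖σ y - σ x‖ ∂m =
      m.real (ball j) * ⨍ y in ball j, ‖σ y - σ x‖ ∂m := by
    have hfinite : IsFiniteMeasure (m.restrict (ball j)) :=
      ⟨by simpa using measure_closedBall_lt_top⟩
    rw [← smul_eq_mul, ← measureReal_restrict_apply_univ, measure_smul_average]
  have havg0 : 0 ≤ ⨍ y in ball j, ‖σ y - σ x‖ ∂m := by
    rw [average_eq]
    exact smul_nonneg (by positivity) (integral_nonneg fun y => norm_nonneg _)
  rw [norm_smul, Real.norm_of_nonneg (hc j).le]
  calc c j * ‖∫ y, f ((r j)⁻¹ • (y - x)) • (σ y - σ x) ∂m‖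
      ≤ c j * (C * (m.real (ball j) * ⨍ y in ball j, ‖σ y - σ x‖ ∂m)) := by
        rw [← havg_eq]; exact mul_le_mul_of_nonneg_left hI (hc j).le
    _ = C * (c j * m.real (ball j)) * ⨍ y in ball j, ‖σ y - σ x‖ ∂m := by ring
    _ ≤ C * 2 ^ (N * i) * ⨍ y in ball j, ‖σ y - σ x‖ ∂m := by gcongr

end BlowUp

/-- A lower bound `2 ^ (-t (i + 1))` at dyadic scales bounds the logarithmic lower limit. -/
lemma liminf_log_div_log_le {g : ℝ → ℝ} {t u : ℝ} (htu : t < u) (hu : 0 ≤ u)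
    (hg : ∀ i : ℕ, (2 : ℝ) ^ (-(t * (i + 1))) ≤ g ((1 / 2) ^ i)) :
    Filter.liminf (fun ρ : ℝ => Real.log (g ρ) / Real.log ρ) (𝓝[>] 0) ≤ u := by
  have hlim : Tendsto (fun i : ℕ => (1 / 2 : ℝ) ^ i) atTop (𝓝[>] 0) :=
    tendsto_nhdsWithin_iff.2 ⟨tendsto_pow_atTop_nhds_zero_of_lt_one (by norm_num) (by norm_num),
      .of_forall fun i => by simp⟩
  have hev : ∀ᶠ i : ℕ in atTop,
      Real.log (g ((1 / 2) ^ i)) / Real.log ((1 / 2 : ℝ) ^ i) ≤ u := by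
    filter_upwards [tendsto_natCast_atTop_atTop.eventually_ge_atTop (t / (u - t)),
      eventually_gt_atTop 0] with i hi hi0
    have hl2 : 0 < Real.log 2 := Real.log_pos one_lt_two
    have hi0' : (0 : ℝ) < i := Nat.cast_pos.2 hi0
    rw [div_le_iff₀ (sub_pos.2 htu)] at hi
    have h1 := Real.log_le_log (by positivity) (hg i)
    rw [Real.log_rpow two_pos] at h1
    have h2 : Real.log ((1 / 2 : ℝ) ^ i) = -(i * Real.log 2) := by
      rw [Real.log_pow, one_div, Real.log_inv]; ring
    rw [h2, div_le_iff_of_neg (by simpa using mul_pos hi0' hl2)]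
    nlinarith
  refine Real.sSup_le (fun a ha => ?_) hu
  rw [mem_ofPred_eq, eventually_map] at ha
  obtain ⟨i, hi1, hi2⟩ := ((hlim.eventually ha).and hev).exists
  exact hi1.trans hi2

/-- Dyadic polynomial growth implies polynomial growth. -/
lemma measure_closedBall_le_of_dyadic {X : Type*} [MetricSpace X] [ProperSpace X]
    [MeasurableSpace X] {ν : Measure X} [IsLocallyFiniteMeasure ν] {o : X} {N : ℕ}
    (h : ∀ i : ℕ, ν.real (closedBall o (2 ^ i)) ≤ 2 ^ (N * (i + 1))) {R : ℝ} (hR : 1 ≤ R) :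
    ν (closedBall o R) ≤ ENNReal.ofReal (2 ^ (2 * N) * R ^ N) := by
  obtain ⟨i, hi1, hi2⟩ := exists_nat_pow_near hR (one_lt_two (α := ℝ))
  refine (measure_mono (closedBall_subset_closedBall hi2.le)).trans ?_
  rw [← ofReal_measureReal measure_closedBall_lt_top.ne]
  refine ENNReal.ofReal_le_ofReal ((h (i + 1)).trans ?_)
  calc (2 : ℝ) ^ (N * (i + 1 + 1)) = 2 ^ (2 * N) * (2 ^ i) ^ N := by ring
    _ ≤ 2 ^ (2 * N) * R ^ N := by gcongr

/-- The real infimum of the dimension exponents admitted by a nonempty class of sets is nonnegative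
and almost attained. -/
lemma exists_dimH_lt_sInf_add {X : Type*} [MetricSpace X] {p : Set X → Prop}
    (hne : ∃ (α : ℝ) (F : Set X), dimH F ≤ ENNReal.ofReal α ∧ p F) {δ : ℝ} (hδ : 0 < δ) :
    0 ≤ sInf {α : ℝ | ∃ F : Set X, dimH F ≤ ENNReal.ofReal α ∧ p F} ∧
      ∃ F : Set X, p F ∧ dimH F <
        ENNReal.ofReal (sInf {α : ℝ | ∃ F : Set X, dimH F ≤ ENNReal.ofReal α ∧ p F} + δ) := by
  set S := {α : ℝ | ∃ F : Set X, dimH F ≤ ENNReal.ofReal α ∧ p F} with hS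
  by_cases hneg : ∃ α ∈ S, α < 0
  · obtain ⟨α, ⟨F, hF, hpF⟩, hα⟩ := hneg
    rw [ENNReal.ofReal_of_nonpos hα.le] at hF
    have hinf : sInf S = 0 := by
      refine Real.sInf_of_not_bddBelow fun ⟨b, hb⟩ => ?_
      have : b ≤ b - 1 := hb ⟨F, hF.trans zero_le, hpF⟩
      linarith
    rw [hinf]
    exact ⟨le_rfl, F, hpF, hF.trans_lt (by simpa using hδ)⟩
  · push Not at hneg
    have h0 : 0 ≤ sInf S := Real.sInf_nonneg hneg
    obtain ⟨α, ⟨F, hF, hpF⟩, hα⟩ := exists_lt_of_csInf_lt hne (lt_add_of_pos_right (sInf S) hδ)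
    exact ⟨h0, F, hpF, hF.trans_lt ((ENNReal.ofReal_lt_ofReal_iff (by positivity)).2 hα)⟩

/-- Theorem 1.4 (`TangentMeasureTheorem`, parts 1–3): a locally finite `ℂˡ`-valued charge
`μ`, represented by its polar decomposition `dμ = σ d m` with `m = |μ|` locally finite and
`‖σ‖ = 1` `m`-a.e., of finite lower Hausdorff dimension, admits a point `x ∈ supp μ`, a
vector `a ≠ 0`, and a non-zero measure `ν` with `a ⊗ ν ∈ Tan(μ,x)`,
`liminf_{r→0} log ν(B(0,r))/log r ≤ dim μ + ε`, and `ν` tempered. -/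
theorem tangent_measure_theorem
    (d l : ℕ) (m : Measure (EuclideanSpace ℝ (Fin d))) [IsLocallyFiniteMeasure m]
    (hm : m ≠ 0)
    (σ : EuclideanSpace ℝ (Fin d) → EuclideanSpace ℂ (Fin l))
    (hσmeas : AEStronglyMeasurable σ m) (hσunit : ∀ᵐ y ∂m, ‖σ y‖ = 1)
    (dimμ : ℝ)
    (hdim : dimμ = sInf {α : ℝ | ∃ F : Set (EuclideanSpace ℝ (Fin d)),
      MeasurableSet F ∧ dimH F ≤ ENNReal.ofReal α ∧ (∫ y in F, σ y ∂m) ≠ 0})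
    (hfin : ∃ α : ℝ, ∃ F : Set (EuclideanSpace ℝ (Fin d)),
      MeasurableSet F ∧ dimH F ≤ ENNReal.ofReal α ∧ (∫ y in F, σ y ∂m) ≠ 0)
    (ε : ℝ) (hε : 0 < ε) :
    ∃ (x : EuclideanSpace ℝ (Fin d)) (a : EuclideanSpace ℂ (Fin l))
      (ν : Measure (EuclideanSpace ℝ (Fin d))) (c r : ℕ → ℝ),
      (∀ ρ : ℝ, 0 < ρ → 0 < m (closedBall x ρ)) ∧
      a ≠ 0 ∧ IsLocallyFiniteMeasure ν ∧ ν ≠ 0 ∧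
      (∀ j, 0 < c j) ∧ (∀ j, 0 < r j) ∧ Tendsto r atTop (𝓝 0) ∧
      -- (1) `a ⊗ ν` is a tangent charge of `μ` at `x`
      (∀ f : C(EuclideanSpace ℝ (Fin d), ℝ), HasCompactSupport f →
        Tendsto (fun j => c j • ∫ y, f ((r j)⁻¹ • (y - x)) • σ y ∂m)
          atTop (𝓝 ((∫ z, f z ∂ν) • a))) ∧
      -- (2) local lower dimension bound at the origin
      (Filter.liminf
          (fun ρ : ℝ => Real.log (ν (closedBall 0 ρ)).toReal / Real.log ρ)
          (𝓝[>] 0) ≤ dimμ + ε) ∧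
      -- (3) `ν` is tempered
      (∃ (N : ℕ) (C : ℝ), 0 < C ∧ ∀ R : ℝ, 1 ≤ R →
        ν (closedBall 0 R) ≤ ENNReal.ofReal (C * R ^ N)) := by
  have hset : {α : ℝ | ∃ F : Set (EuclideanSpace ℝ (Fin d)),
      MeasurableSet F ∧ dimH F ≤ ENNReal.ofReal α ∧ (∫ y in F, σ y ∂m) ≠ 0} =
      {α : ℝ | ∃ F : Set (EuclideanSpace ℝ (Fin d)), dimH F ≤ ENNReal.ofReal α ∧
        (MeasurableSet F ∧ (∫ y in F, σ y ∂m) ≠ 0)} := by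
    ext α
    exact exists_congr fun F => and_left_comm
  obtain ⟨hD0, F, ⟨hFm, hF0⟩, hFdim⟩ := exists_dimH_lt_sInf_add
    (p := fun F : Set (EuclideanSpace ℝ (Fin d)) => MeasurableSet F ∧ (∫ y in F, σ y ∂m) ≠ 0)
    (by obtain ⟨α, F, h1, h2, h3⟩ := hfin; exact ⟨α, F, h2, h1, h3⟩) (δ := ε / 4) (by positivity)
  rw [← hset, ← hdim] at hD0 hFdim
  set s : ℝ≥0 := (dimμ + ε / 4).toNNReal with hs
  have hs_coe : (s : ℝ) = dimμ + ε / 4 := Real.coe_toNNReal _ (by positivity)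
  have hs0 : (0 : ℝ) < s := by rw [hs_coe]; positivity
  have hσ : LocallyIntegrable σ m := by
    refine (locallyIntegrable_const (1 : ℝ)).mono hσmeas ?_
    filter_upwards [hσunit] with y hy
    simp [hy]
  have hmF : ∃ᵐ x ∂m, x ∈ F := by
    intro h
    refine hF0 ?_
    rw [Measure.restrict_eq_zero.2 (measure_eq_zero_iff_ae_notMem.2 h), integral_zero_measure]
  have hsupp : ∀ᵐ x ∂m, x ∈ m.support := Measure.support_mem_ae
  obtain ⟨x, hxF, hxfreq, hxunit, hxleb, hxsupp⟩ := (hmF.and_eventually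
    ((ae_frequently_le_measure_closedBall m hFm (NNReal.coe_pos.1 hs0) hFdim).and
      (hσunit.and (((Besicovitch.vitaliFamily m).ae_tendsto_average_norm_sub hσ).and
        hsupp)))).exists
  have hball : ∀ ρ : ℝ, 0 < ρ → 0 < m (closedBall x ρ) := fun ρ hρ =>
    (Measure.mem_support_iff_forall x).1 hxsupp _ (closedBall_mem_nhds x hρ)
  have hpos : ∀ k : ℕ, 0 < m.real (closedBall x ((1 / 2) ^ k)) := fun k =>
    ENNReal.toReal_pos (hball _ (by positivity)).ne' measure_closedBall_lt_top.ne
  obtain ⟨N, hN⟩ := exists_decay_controlled_index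
    (φ := fun k : ℕ => m.real (closedBall x ((1 / 2) ^ k)))
    (fun a b hab => measureReal_mono (closedBall_subset_closedBall
      (pow_le_pow_of_le_one (by norm_num) (by norm_num) hab)) measure_closedBall_lt_top.ne)
    hpos hs0 (show (s : ℝ) < dimμ + ε / 2 by linarith) ((hxfreq hxF).mono fun k hk => by
      have h1 := ENNReal.toReal_mono measure_closedBall_lt_top.ne hk
      rw [← ENNReal.toReal_rpow, ENNReal.toReal_ofReal (by positivity)] at h1
      refine le_of_eq_of_le ?_ h1
      rw [one_div, inv_pow, ← Real.rpow_natCast, ← Real.rpow_neg two_pos.le,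
        ← Real.rpow_mul two_pos.le]
      ring_nf)
  obtain ⟨ν, c, r, hν, hc, hr, hrlim, hconv, hgrowth, hup, hlow⟩ := exists_tangent_measure hpos hN
  refine ⟨x, σ x, ν, c, r, hball, ?_, hν, ?_, hc, hr, hrlim, fun f hf => ?_, ?_,
    N, 2 ^ (2 * N), by positivity, fun R hR => measure_closedBall_le_of_dyadic hup hR⟩
  · rw [← norm_pos_iff, hxunit]
    exact one_pos
  · rintro rfl
    have h := hlow 0
    simp only [measureReal_zero_apply] at h
    exact absurd h (not_le.2 (by positivity))
  · exact tendsto_smul_integral_of_lebesgue_point hσ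
      (hxleb.comp (Besicovitch.tendsto_filterAt m x)) hc hr hrlim hgrowth hf (hconv f hf)
  · exact liminf_log_div_log_le (by linarith) (by positivity) hlow
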